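/- arXiv:2004.04155 — 3 statements merged into one kernel-verified Lean document; each statement's English description precedes it below -/
import Mathlib

section
/- Let T : A → B be a bijective bounded linear operator between C*-algebras. The following are equivalent: (i) T is orthogonality preserving; (ii) T preserves zero triple products, i.e., for all a, b, c ∈ A, {a,b,c} = 0 implies {T(a),T(b),T(c)} = 0; (iii) T preserves zero triple products in both directions, i.e., for all a, b, c ∈ A, {a,b,c} = 0 if and only if {T(a),T(b),T(c)} = 0. -/
/-- Two elements `a, b` of a C*-algebra are orthogonal if `a b* = 0` and `b* a = 0`. -/
def IsOrthogonal {A : Type*} [NonUnitalCStarAlgebra A] (a b : A) : Prop :=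
  a * star b = 0 ∧ star b * a = 0

/-- The canonical triple product `{a,b,c} = (a b* c + c b* a) / 2` of a C*-algebra. -/
noncomputable def tripleProduct {A : Type*} [NonUnitalCStarAlgebra A] (a b c : A) : A :=
  (2 : ℂ)⁻¹ • (a * star b * c + c * star b * a)


noncomputable def hatFn (x : ℝ) : ℝ := max 0 (1 - |x|)

lemma hatFn_nonneg (x : ℝ) : 0 ≤ hatFn x := le_max_left _ _

lemma hatFn_continuous : Continuous hatFn := by unfold hatFn; fun_prop

lemma hatFn_zero {x : ℝ} (h : 1 ≤ |x|) : hatFn x = 0 := by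
  unfold hatFn; exact max_eq_left (by linarith)

lemma hatFn_sum (x : ℝ) (c : ℤ → ℝ) (S : Finset ℤ) (h1 : ⌊x⌋ ∈ S) (h2 : ⌊x⌋ + 1 ∈ S) :
    ∑ i ∈ S, c i * hatFn (x - i) = c ⌊x⌋ * (1 - Int.fract x) + c (⌊x⌋ + 1) * Int.fract x := by
  have hx := Int.floor_add_fract x
  have h0 := Int.fract_nonneg x
  have h1' := Int.fract_lt_one x
  have hsub : ({⌊x⌋, ⌊x⌋ + 1} : Finset ℤ) ⊆ S := by
    intro i hi
    simp only [Finset.mem_insert, Finset.mem_singleton] at hi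
    rcases hi with rfl | rfl <;> assumption
  rw [← Finset.sum_subset hsub]
  · rw [Finset.sum_pair (by omega)]
    have e1 : hatFn (x - (⌊x⌋ : ℤ)) = 1 - Int.fract x := by
      unfold hatFn
      rw [show x - (⌊x⌋ : ℤ) = Int.fract x by linarith, abs_of_nonneg h0, max_eq_right (by linarith)]
    have e2 : hatFn (x - ((⌊x⌋ + 1 : ℤ) : ℝ)) = Int.fract x := by
      unfold hatFn
      rw [show x - ((⌊x⌋ + 1 : ℤ) : ℝ) = Int.fract x - 1 by push_cast; linarith,
        abs_of_nonpos (by linarith), max_eq_right (by linarith)]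
      ring
    rw [e1, e2]
  · intro i _ hi
    simp only [Finset.mem_insert, Finset.mem_singleton, not_or] at hi
    rw [hatFn_zero, mul_zero]
    rcases lt_or_gt_of_ne hi.1 with h | h
    · have : (i : ℝ) + 1 ≤ ⌊x⌋ := by exact_mod_cast h
      rw [abs_of_nonneg (by linarith)]; linarith
    · have : ⌊x⌋ + 2 ≤ i := by omega
      have : (⌊x⌋ : ℝ) + 2 ≤ i := by exact_mod_cast this
      rw [abs_of_nonpos (by linarith)]; linarith

lemma hatFn_sum_le (x : ℝ) (S : Finset ℤ) : ∑ i ∈ S, hatFn (x - i) ≤ 1 := by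
  have h := hatFn_sum x (fun _ => 1) (S ∪ {⌊x⌋, ⌊x⌋ + 1}) (by simp) (by simp)
  simp only [one_mul] at h
  have : ∑ i ∈ S, hatFn (x - i) ≤ ∑ i ∈ S ∪ {⌊x⌋, ⌊x⌋ + 1}, hatFn (x - i) :=
    Finset.sum_le_sum_of_subset_of_nonneg Finset.subset_union_left
      (fun _ _ _ => hatFn_nonneg _)
  linarith

section hats
variable {X : Type*} [TopologicalSpace X]
  {E : Type*} [NormedAddCommGroup E] [NormedSpace ℝ E]

noncomputable def hatC (σ : C(X, ℝ)) (i : ℤ) : C(X, ℝ) :=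
  ⟨fun x => hatFn (σ x - i), hatFn_continuous.comp (by fun_prop)⟩

lemma hatC_mul (σ : C(X, ℝ)) (i j : ℤ) (h : 2 ≤ |i - j|) : hatC σ i * hatC σ j = 0 := by
  ext x
  simp only [hatC, ContinuousMap.mul_apply, ContinuousMap.coe_mk, ContinuousMap.zero_apply]
  by_cases hi : 1 ≤ |σ x - i|
  · rw [hatFn_zero hi, zero_mul]
  · rw [hatFn_zero (x := σ x - j), mul_zero]
    have h2 : (2 : ℝ) ≤ |(i : ℝ) - j| := by exact_mod_cast h
    have h3 := abs_sub_le (i : ℝ) (σ x) j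
    rw [abs_sub_comm (i : ℝ) (σ x)] at h3
    linarith

variable [CompactSpace X]

lemma hatC_sum_norm (σ : C(X, ℝ)) (S : Finset ℤ) : ‖∑ i ∈ S, hatC σ i‖ ≤ 1 := by
  rw [ContinuousMap.norm_le _ zero_le_one]
  intro x
  rw [ContinuousMap.sum_apply, Real.norm_of_nonneg]
  · exact hatFn_sum_le _ _
  · exact Finset.sum_nonneg fun _ _ => hatFn_nonneg _

lemma hatC_sum_norm' (σ : C(X, ℝ)) (S : Finset ℤ) : ‖∑ i ∈ S, hatC σ (i + 1)‖ ≤ 1 := by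
  have := hatC_sum_norm σ (S.map (addRightEmbedding 1))
  simpa using this

lemma hat_bound (W : C(X, ℝ) →ₗ[ℝ] C(X, ℝ) →ₗ[ℝ] E) (C : ℝ) (hC : 0 ≤ C)
    (hW : ∀ f g, ‖W f g‖ ≤ C * ‖f‖ * ‖g‖) (hz : ∀ f g, f * g = 0 → W f g = 0)
    (σ : C(X, ℝ)) (S : Finset ℤ) :
    ‖∑ j ∈ S, W (hatC σ (j + 1)) (hatC σ j)‖ ≤ 3 * C := by
  have key : ∀ r : ℤ, ‖∑ j ∈ S with j % 3 = r, W (hatC σ (j + 1)) (hatC σ j)‖ ≤ C := by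
    intro r
    set R := S.filter (fun j => j % 3 = r) with hR
    have : ∑ j ∈ R, W (hatC σ (j + 1)) (hatC σ j)
        = W (∑ j ∈ R, hatC σ (j + 1)) (∑ j ∈ R, hatC σ j) := by
      rw [map_sum W, LinearMap.sum_apply]
      refine Finset.sum_congr rfl fun i hi => ?_
      rw [map_sum, Finset.sum_eq_single_of_mem i hi]
      intro j hj hji
      apply hz
      apply hatC_mul
      simp only [hR, Finset.mem_filter] at hi hj
      rw [le_abs]
      omega
    rw [this]
    refine (hW _ _).trans ?_
    have h1 := hatC_sum_norm' σ R
    have h2 := hatC_sum_norm σ R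
    have h3 := mul_le_mul h1 h2 (norm_nonneg _) zero_le_one
    rw [mul_assoc]
    nlinarith
  have hs : ∑ j ∈ S, W (hatC σ (j + 1)) (hatC σ j)
      = ∑ r ∈ ({0, 1, 2} : Finset ℤ), ∑ j ∈ S with j % 3 = r, W (hatC σ (j + 1)) (hatC σ j) := by
    rw [Finset.sum_fiberwise_of_maps_to]
    intro j _
    simp only [Finset.mem_insert, Finset.mem_singleton]
    omega
  rw [hs]
  refine (norm_sum_le _ _).trans ((Finset.sum_le_card_nsmul _ _ C fun r _ => key r).trans ?_)
  simp

lemma bilin_bound (W : C(X, ℝ) →ₗ[ℝ] C(X, ℝ) →ₗ[ℝ] E) (C : ℝ) (hC : 0 ≤ C)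
    (hW : ∀ f g, ‖W f g‖ ≤ C * ‖f‖ * ‖g‖) (hz : ∀ f g, f * g = 0 → W f g = 0)
    (σ : C(X, ℝ)) : ‖W σ 1 - W 1 σ‖ ≤ 6 * C := by
  obtain ⟨M, hM⟩ := exists_nat_ge (‖σ‖ + 2)
  set I : Finset ℤ := Finset.Icc (-M) M with hI
  have hmem : ∀ x, ⌊σ x⌋ ∈ I ∧ ⌊σ x⌋ + 1 ∈ I := by
    intro x
    have h1 := abs_le.1 (σ.norm_coe_le_norm x)
    have h2 : (⌊σ x⌋ : ℝ) ≤ σ x := Int.floor_le _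
    have h3 : σ x < ⌊σ x⌋ + 1 := Int.lt_floor_add_one _
    have h4 : -(M : ℝ) ≤ ⌊σ x⌋ := by linarith
    have h5 : (⌊σ x⌋ : ℝ) + 1 ≤ M := by linarith
    have h4' : -(M : ℤ) ≤ ⌊σ x⌋ := by exact_mod_cast h4
    have h5' : ⌊σ x⌋ + 1 ≤ (M : ℤ) := by exact_mod_cast h5
    simp only [hI, Finset.mem_Icc]; omega
  have e1 : ∑ i ∈ I, hatC σ i = 1 := by
    ext x
    have := hatFn_sum (σ x) (fun _ => 1) I (hmem x).1 (hmem x).2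
    simp only [one_mul] at this
    rw [ContinuousMap.sum_apply]
    simp only [hatC, ContinuousMap.coe_mk, ContinuousMap.one_apply]
    rw [this]; ring
  have e2 : ∑ i ∈ I, (i : ℝ) • hatC σ i = σ := by
    ext x
    have := hatFn_sum (σ x) (fun i => i) I (hmem x).1 (hmem x).2
    rw [ContinuousMap.sum_apply]
    simp only [hatC, ContinuousMap.smul_apply, ContinuousMap.coe_mk, smul_eq_mul]
    rw [this]
    have := Int.floor_add_fract (σ x)
    push_cast
    linarith
  have hsplit : W σ 1 - W 1 σ = ∑ j ∈ I with j + 1 ∈ I, W (hatC σ (j + 1)) (hatC σ j)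
      - ∑ i ∈ I with i + 1 ∈ I, W.flip (hatC σ (i + 1)) (hatC σ i) := by
    have a1 : W σ 1 = ∑ i ∈ I, ∑ j ∈ I, (i : ℝ) • W (hatC σ i) (hatC σ j) := by
      have : W (∑ i ∈ I, (i : ℝ) • hatC σ i) (∑ i ∈ I, hatC σ i)
          = ∑ i ∈ I, ∑ j ∈ I, (i : ℝ) • W (hatC σ i) (hatC σ j) := by
        rw [map_sum W, LinearMap.sum_apply]
        refine Finset.sum_congr rfl fun i _ => ?_
        rw [map_sum, map_smul]; rfl
      rwa [e1, e2] at this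
    have a2 : W 1 σ = ∑ i ∈ I, ∑ j ∈ I, (j : ℝ) • W (hatC σ i) (hatC σ j) := by
      have : W (∑ i ∈ I, hatC σ i) (∑ i ∈ I, (i : ℝ) • hatC σ i)
          = ∑ i ∈ I, ∑ j ∈ I, (j : ℝ) • W (hatC σ i) (hatC σ j) := by
        rw [map_sum W, LinearMap.sum_apply]
        refine Finset.sum_congr rfl fun i _ => ?_
        rw [map_sum]
        refine Finset.sum_congr rfl fun j _ => ?_
        rw [map_smul]
      rwa [e1, e2] at this
    have a3 : ∑ j ∈ I with j + 1 ∈ I, W (hatC σ (j + 1)) (hatC σ j)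
        = ∑ i ∈ I, ∑ j ∈ I, if i = j + 1 then W (hatC σ i) (hatC σ j) else 0 := by
      rw [Finset.sum_comm, Finset.sum_filter]
      refine Finset.sum_congr rfl fun j _ => ?_
      rw [Finset.sum_ite_eq' I (j + 1)]
    have a4 : ∑ i ∈ I with i + 1 ∈ I, W.flip (hatC σ (i + 1)) (hatC σ i)
        = ∑ i ∈ I, ∑ j ∈ I, if j = i + 1 then W (hatC σ i) (hatC σ j) else 0 := by
      rw [Finset.sum_filter]
      refine Finset.sum_congr rfl fun i _ => ?_
      rw [Finset.sum_ite_eq' I (i + 1)]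
      rfl
    rw [a1, a2, a3, a4, ← Finset.sum_sub_distrib, ← Finset.sum_sub_distrib]
    refine Finset.sum_congr rfl fun i _ => ?_
    rw [← Finset.sum_sub_distrib, ← Finset.sum_sub_distrib]
    refine Finset.sum_congr rfl fun j _ => ?_
    by_cases h1 : i = j + 1
    · subst h1
      rw [if_pos rfl, if_neg (by omega), ← sub_smul]
      push_cast
      simp
    by_cases h2 : j = i + 1
    · subst h2
      rw [if_neg (by omega), if_pos rfl, ← sub_smul]
      push_cast
      simp
    rw [if_neg h1, if_neg h2, ← sub_smul]
    by_cases h3 : i = j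
    · simp [h3]
    · rw [hz _ _ (hatC_mul σ i j (by rw [le_abs]; omega))]; simp
  rw [hsplit]
  have b1 := hat_bound W C hC hW hz σ (I.filter (fun j => j + 1 ∈ I))
  have b2 := hat_bound W.flip C hC (fun f g => by
    rw [LinearMap.flip_apply]; refine (hW _ _).trans (le_of_eq (by ring)))
    (fun f g h => by rw [LinearMap.flip_apply]; exact hz _ _ (by rw [mul_comm]; exact h))
    σ (I.filter (fun j => j + 1 ∈ I))
  refine (norm_sub_le _ _).trans ?_
  linarith

lemma bilin_comm (W : C(X, ℝ) →ₗ[ℝ] C(X, ℝ) →ₗ[ℝ] E) (C : ℝ) (hC : 0 ≤ C)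
    (hW : ∀ f g, ‖W f g‖ ≤ C * ‖f‖ * ‖g‖) (hz : ∀ f g, f * g = 0 → W f g = 0)
    (σ : C(X, ℝ)) : W σ 1 = W 1 σ := by
  rw [← sub_eq_zero, ← norm_le_zero_iff]
  by_contra! h
  obtain ⟨n, hn⟩ := exists_nat_gt (6 * C / ‖W σ 1 - W 1 σ‖)
  have := bilin_bound W C hC hW hz ((n : ℝ) • σ)
  rw [map_smul, map_smul, LinearMap.smul_apply, ← smul_sub, norm_smul] at this
  rw [div_lt_iff₀ h] at hn
  simp at this
  linarith

lemma bilin_mul (W : C(X, ℝ) →ₗ[ℝ] C(X, ℝ) →ₗ[ℝ] E) (C : ℝ) (hC : 0 ≤ C)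
    (hW : ∀ f g, ‖W f g‖ ≤ C * ‖f‖ * ‖g‖) (hz : ∀ f g, f * g = 0 → W f g = 0)
    (σ p : C(X, ℝ)) : W (σ * p) 1 = W p σ := by
  have := bilin_comm (W.comp (LinearMap.mulRight ℝ p)) (C * ‖p‖) (by positivity)
    (fun f g => by
      simp only [LinearMap.comp_apply, LinearMap.mulRight_apply]
      refine (hW _ _).trans ?_
      have := norm_mul_le f p
      have h2 : C * ‖f * p‖ ≤ C * (‖f‖ * ‖p‖) := by gcongr
      calc C * ‖f * p‖ * ‖g‖ ≤ C * (‖f‖ * ‖p‖) * ‖g‖ := by gcongr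
        _ = _ := by ring)
    (fun f g h => by
      simp only [LinearMap.comp_apply, LinearMap.mulRight_apply]
      apply hz
      rw [mul_right_comm, h, zero_mul]) σ
  simpa using this
end hats

section key
variable {A : Type*} [NonUnitalCStarAlgebra A]

/-- the part of a continuous function vanishing at zero -/
noncomputable def dropConst {a : A} (k : C(quasispectrum ℝ a, ℝ)) :
    ContinuousMapZero (quasispectrum ℝ a) ℝ :=
  ⟨k - ContinuousMap.const _ (k 0), by simp⟩

noncomputable def piMap (e a : A) (ha : IsSelfAdjoint a) : C(quasispectrum ℝ a, ℝ) →ₗ[ℝ] A where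
  toFun k := k 0 • e + cfcₙHom (R := ℝ) ha (dropConst k)
  map_add' k l := by
    have : dropConst (k + l) = dropConst k + dropConst l := by
      ext x; simp [dropConst]; ring
    rw [this, map_add, ContinuousMap.add_apply, add_smul]; abel
  map_smul' r k := by
    have : dropConst (r • k) = r • dropConst k := by
      ext x; simp [dropConst]; ring
    rw [this, map_smul, ContinuousMap.smul_apply, RingHom.id_apply, smul_add, smul_eq_mul, mul_smul]

lemma piMap_apply (e a : A) (ha : IsSelfAdjoint a) (k : C(quasispectrum ℝ a, ℝ)) :
    piMap e a ha k = k 0 • e + cfcₙHom (R := ℝ) ha (dropConst k) := rfl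

lemma piMap_sa (e a : A) (he : IsSelfAdjoint e) (ha : IsSelfAdjoint a)
    (k : C(quasispectrum ℝ a, ℝ)) : IsSelfAdjoint (piMap e a ha k) := by
  rw [piMap_apply]
  exact ((IsSelfAdjoint.all (k 0)).smul he).add (cfcₙHom_predicate ha _)

lemma piMap_norm (e a : A) (ha : IsSelfAdjoint a) (k : C(quasispectrum ℝ a, ℝ)) :
    ‖piMap e a ha k‖ ≤ (‖e‖ + 2) * ‖k‖ := by
  rw [piMap_apply]
  have h0 : ‖k 0‖ ≤ ‖k‖ := k.norm_coe_le_norm 0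
  have h1 : ‖cfcₙHom (R := ℝ) ha (dropConst k)‖ ≤ 2 * ‖k‖ := by
    rw [norm_cfcₙHom a _ ha, ContinuousMapZero.norm_def]
    rw [ContinuousMap.norm_le _ (by positivity)]
    intro x
    have h2 : ‖k x‖ ≤ ‖k‖ := k.norm_coe_le_norm x
    have : ‖k x - k 0‖ ≤ 2 * ‖k‖ := (norm_sub_le _ _).trans (by linarith)
    simpa [dropConst] using this
  refine (norm_add_le _ _).trans ?_
  rw [norm_smul]
  nlinarith [norm_nonneg e]

lemma unit_act (e a : A) (ha : IsSelfAdjoint a) (h : e * a = a)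
    (f : ContinuousMapZero (quasispectrum ℝ a) ℝ) : e * cfcₙHom (R := ℝ) ha f = cfcₙHom ha f := by
  induction f using ContinuousMapZero.induction_on_of_compact with
  | zero => simp [map_zero]
  | id => rw [cfcₙHom_id ha]; exact h
  | star_id => rw [map_star, cfcₙHom_id ha, ha.star_eq]; exact h
  | add _ _ h₁ h₂ => simp only [map_add, mul_add, h₁, h₂]
  | mul _ _ h _ => simp only [map_mul, ← mul_assoc, h]
  | smul _ _ h => rw [map_smul, mul_smul_comm, h]
  | frequently f h =>
    have hc := cfcₙHom_continuous (R := ℝ) ha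
    exact h.mem_of_closed <| isClosed_eq (by fun_prop) (by fun_prop)

lemma unit_act' (e a : A) (he : IsSelfAdjoint e) (ha : IsSelfAdjoint a) (h : e * a = a)
    (f : ContinuousMapZero (quasispectrum ℝ a) ℝ) : cfcₙHom (R := ℝ) ha f * e = cfcₙHom ha f := by
  have := congrArg star (unit_act e a ha h f)
  have h2 : IsSelfAdjoint (cfcₙHom (R := ℝ) ha f) := cfcₙHom_predicate ha f
  rwa [star_mul, he.star_eq, h2.star_eq] at this

lemma piMap_mul_zero (e a : A) (he : IsSelfAdjoint e) (ha : IsSelfAdjoint a) (h : e * a = a)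
    (k l : C(quasispectrum ℝ a, ℝ)) (hkl : k * l = 0) (hl : l 0 = 0) :
    piMap e a ha k * piMap e a ha l = 0 ∧ piMap e a ha l * piMap e a ha k = 0 := by
  have hp : ∀ x, k x * l x = 0 := fun x => by
    have := DFunLike.congr_fun hkl x
    simpa using this
  have e1 : k 0 • dropConst l + dropConst k * dropConst l = 0 := by
    ext x
    simp only [dropConst, hl]
    simp
    linear_combination hp x
  have e2 := congrArg (cfcₙHom (R := ℝ) ha) e1
  rw [map_add, map_smul, map_mul, map_zero (cfcₙHom (R := ℝ) ha)] at e2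
  have e3 := e2
  rw [← map_mul, mul_comm, map_mul] at e3
  simp only [piMap_apply, hl, zero_smul, zero_add]
  constructor
  · rw [add_mul, smul_mul_assoc, unit_act e a ha h]; exact e2
  · rw [mul_add, mul_smul_comm, unit_act' e a he ha h]; exact e3

lemma key_bilin {E : Type*} [NormedAddCommGroup E] [NormedSpace ℝ E]
    (V : A →ₗ[ℝ] A →ₗ[ℝ] E) (C : ℝ) (hC : 0 ≤ C) (hb : ∀ x y, ‖V x y‖ ≤ C * ‖x‖ * ‖y‖)
    (hV : ∀ x y, IsSelfAdjoint x → IsSelfAdjoint y → x * y = 0 → y * x = 0 → V x y = 0)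
    (e a : A) (he : IsSelfAdjoint e) (ha : IsSelfAdjoint a) (h : e * a = a) :
    V a e = V e a ∧ V (a * a) e = V a a := by
  set p := piMap e a ha
  let W : C(quasispectrum ℝ a, ℝ) →ₗ[ℝ] C(quasispectrum ℝ a, ℝ) →ₗ[ℝ] E := V.compl₁₂ p p
  have hW : ∀ f g, ‖W f g‖ ≤ (C * (‖e‖ + 2) * (‖e‖ + 2)) * ‖f‖ * ‖g‖ := by
    intro f g
    change ‖V (p f) (p g)‖ ≤ _
    refine (hb _ _).trans ?_
    have h1 := piMap_norm e a ha f
    have h2 := piMap_norm e a ha g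
    calc C * ‖p f‖ * ‖p g‖ ≤ C * ((‖e‖ + 2) * ‖f‖) * ((‖e‖ + 2) * ‖g‖) := by gcongr
      _ = _ := by ring
  have hz : ∀ f g, f * g = 0 → W f g = 0 := by
    intro f g hfg
    have h0 : f 0 * g 0 = 0 := by
      have := DFunLike.congr_fun hfg 0
      simpa using this
    have hs := piMap_sa e a he ha
    rcases mul_eq_zero.1 h0 with h0 | h0
    · have := piMap_mul_zero e a he ha h g f (by rw [mul_comm]; exact hfg) h0
      exact hV _ _ (hs _) (hs _) this.2 this.1
    · have := piMap_mul_zero e a he ha h f g hfg h0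
      exact hV _ _ (hs _) (hs _) this.1 this.2
  let τ : C(quasispectrum ℝ a, ℝ) := ⟨fun x => x, by fun_prop⟩
  have hτ : p τ = a := by
    change piMap e a ha τ = a
    rw [piMap_apply]
    have : dropConst τ = ContinuousMapZero.id (quasispectrum ℝ a) := by
      ext x; simp [dropConst, τ]
    rw [this, cfcₙHom_id ha]
    simp [τ]
  have hττ : p (τ * τ) = a * a := by
    change piMap e a ha (τ * τ) = a * a
    rw [piMap_apply]
    have : dropConst (τ * τ) = ContinuousMapZero.id (quasispectrum ℝ a) *
        ContinuousMapZero.id (quasispectrum ℝ a) := by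
      ext x; simp [dropConst, τ]
    rw [this, map_mul, cfcₙHom_id ha]
    simp [τ]
  have h1 : p 1 = e := by
    change piMap e a ha 1 = e
    rw [piMap_apply]
    have : dropConst (1 : C(quasispectrum ℝ a, ℝ)) = 0 := by
      ext x; simp [dropConst]
    rw [this, map_zero (cfcₙHom (R := ℝ) ha)]
    simp
  have c1 := bilin_comm W _ (by positivity) hW hz τ
  have c2 := bilin_mul W _ (by positivity) hW hz τ τ
  simp only [W, LinearMap.compl₁₂_apply, hτ, hττ, h1] at c1 c2
  exact ⟨c1, c2⟩

end key

section op
variable {A B : Type*} [NonUnitalCStarAlgebra A] [NonUnitalCStarAlgebra B]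

lemma op_sa (T : A →L[ℂ] B) (hT : ∀ a b : A, IsOrthogonal a b → IsOrthogonal (T a) (T b))
    (e a : A) (he : IsSelfAdjoint e) (ha : IsSelfAdjoint a) (h : e * a = a) :
    (T a * star (T e) = T e * star (T a) ∧ T (a * a) * star (T e) = T a * star (T a)) ∧
    (star (T a) * T e = star (T e) * T a ∧ star (T (a * a)) * T e = star (T a) * T a) := by
  have hr : ∀ (r : ℝ) (x : A), T (r • x) = r • T x := fun r x =>
    (T.restrictScalars ℝ).map_smul r x
  have hnn : ∀ x y : A, ‖T x‖ * ‖T y‖ ≤ ‖T‖ * ‖T‖ * ‖x‖ * ‖y‖ := fun x y => by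
    have h1 := T.le_opNorm x
    have h2 := T.le_opNorm y
    calc ‖T x‖ * ‖T y‖ ≤ (‖T‖ * ‖x‖) * (‖T‖ * ‖y‖) := by gcongr
      _ = _ := by ring
  constructor
  · refine key_bilin (LinearMap.mk₂ ℝ (fun x y => T x * star (T y)) ?_ ?_ ?_ ?_) (‖T‖ * ‖T‖)
      (by positivity) ?_ ?_ e a he ha h
    · intro x y z; simp [add_mul]
    · intro r x y; simp only [hr, smul_mul_assoc]
    · intro x y z; simp [mul_add]
    · intro r x y; simp only [hr, star_smul, mul_smul_comm]; try simp
    · intro x y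
      rw [LinearMap.mk₂_apply]
      refine (norm_mul_le _ _).trans ?_
      rw [norm_star]; exact hnn x y
    · intro x y hx hy h1 h2
      rw [LinearMap.mk₂_apply]
      refine (hT x y ⟨?_, ?_⟩).1
      · rw [hy.star_eq, h1]
      · rw [hy.star_eq, h2]
  · refine key_bilin (LinearMap.mk₂ ℝ (fun x y => star (T x) * T y) ?_ ?_ ?_ ?_) (‖T‖ * ‖T‖)
      (by positivity) ?_ ?_ e a he ha h
    · intro x y z; simp [add_mul]
    · intro r x y; simp only [hr, star_smul, smul_mul_assoc]; try simp
    · intro x y z; simp [mul_add]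
    · intro r x y; simp only [hr, mul_smul_comm]
    · intro x y
      rw [LinearMap.mk₂_apply]
      refine (norm_mul_le _ _).trans ?_
      rw [norm_star]; exact hnn x y
    · intro x y hx hy h1 h2
      rw [LinearMap.mk₂_apply]
      refine (hT y x ⟨?_, ?_⟩).2
      · rw [hx.star_eq, h2]
      · rw [hx.star_eq, h1]

/-- the set on which `e` acts as a unit -/
def ActsUnit (e a : A) : Prop := e * a = a ∧ a * e = a

lemma ActsUnit.star' {e a : A} (he : IsSelfAdjoint e) (h : ActsUnit e a) : ActsUnit e (star a) := by
  constructor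
  · have := congrArg star h.2
    rwa [star_mul, he.star_eq] at this
  · have := congrArg star h.1
    rwa [star_mul, he.star_eq] at this

lemma ActsUnit.add' {e a b : A} (h : ActsUnit e a) (h' : ActsUnit e b) : ActsUnit e (a + b) :=
  ⟨by rw [mul_add, h.1, h'.1], by rw [add_mul, h.2, h'.2]⟩

lemma ActsUnit.sub' {e a b : A} (h : ActsUnit e a) (h' : ActsUnit e b) : ActsUnit e (a - b) :=
  ⟨by rw [mul_sub, h.1, h'.1], by rw [sub_mul, h.2, h'.2]⟩

lemma ActsUnit.mul' {e a b : A} (h : ActsUnit e a) (h' : ActsUnit e b) : ActsUnit e (a * b) :=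
  ⟨by rw [← mul_assoc, h.1], by rw [mul_assoc, h'.2]⟩

lemma ActsUnit.smul' {e a : A} (r : ℂ) (h : ActsUnit e a) : ActsUnit e (r • a) :=
  ⟨by rw [mul_smul_comm, h.1], by rw [smul_mul_assoc, h.2]⟩

lemma lin_ext {E : Type*} [AddCommGroup E] [Module ℂ E] (G : A →ₗ[ℂ] E) (e : A)
    (he : IsSelfAdjoint e) (hG : ∀ a, IsSelfAdjoint a → ActsUnit e a → G a = 0)
    (a : A) (ha : ActsUnit e a) : G a = 0 := by
  have h1 := hG (a + star a) (IsSelfAdjoint.add_star_self a) (ha.add' (ha.star' he))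
  have h2 := hG (Complex.I • (a - star a)) (by
    rw [IsSelfAdjoint]; simp [smul_sub]; abel) ((ha.sub' (ha.star' he)).smul' _)
  rw [map_smul, smul_eq_zero_iff_right Complex.I_ne_zero] at h2
  have h3 : (2 : ℂ) • G a = 0 := by
    rw [two_smul]
    rw [map_add] at h1
    rw [map_sub] at h2
    rw [sub_eq_zero] at h2
    rw [← h2] at h1
    exact h1
  rwa [smul_eq_zero_iff_right two_ne_zero] at h3

/-- `x ↦ T(x*)*` -/
noncomputable def conjMap (T : A →L[ℂ] B) : A →ₗ[ℂ] B where
  toFun x := star (T (star x))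
  map_add' x y := by simp
  map_smul' r x := by simp

lemma conjMap_apply (T : A →L[ℂ] B) (x : A) : conjMap T x = star (T (star x)) := rfl

lemma op_lin (T : A →L[ℂ] B) (hT : ∀ a b : A, IsOrthogonal a b → IsOrthogonal (T a) (T b))
    (e : A) (he : IsSelfAdjoint e) (a : A) (ha : ActsUnit e a) :
    T a * star (T e) = T e * conjMap T a ∧ conjMap T a * T e = star (T e) * T a := by
  constructor
  · rw [← sub_eq_zero]
    let G : A →ₗ[ℂ] B := (LinearMap.mulRight ℂ (star (T e))).comp (T : A →ₗ[ℂ] B)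
      - (LinearMap.mulLeft ℂ (T e)).comp (conjMap T)
    refine lin_ext G e he (fun a hs ha => ?_) a ha
    change T a * star (T e) - T e * star (T (star a)) = 0
    rw [hs.star_eq, sub_eq_zero]
    exact (op_sa T hT e a he hs ha.1).1.1
  · rw [← sub_eq_zero]
    let G : A →ₗ[ℂ] B := (LinearMap.mulRight ℂ (T e)).comp (conjMap T)
      - (LinearMap.mulLeft ℂ (star (T e))).comp (T : A →ₗ[ℂ] B)
    refine lin_ext G e he (fun a hs ha => ?_) a ha
    change star (T (star a)) * T e - star (T e) * T a = 0
    rw [hs.star_eq, sub_eq_zero]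
    exact (op_sa T hT e a he hs ha.1).2.1

lemma bilin_ext {E : Type*} [AddCommGroup E] [Module ℂ E] (F : A →ₗ[ℂ] A →ₗ[ℂ] E) (e : A)
    (he : IsSelfAdjoint e) (hsymm : ∀ a b, F a b = F b a)
    (hF : ∀ a, IsSelfAdjoint a → ActsUnit e a → F a a = 0)
    (a b : A) (ha : ActsUnit e a) (hb : ActsUnit e b) : F a b = 0 := by
  have h1 : ∀ a b, IsSelfAdjoint a → ActsUnit e a → IsSelfAdjoint b → ActsUnit e b →
      F a b = 0 := by
    intro a b hs ha hs' hb
    have h := hF (a + b) (hs.add hs') (ha.add' hb)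
    rw [map_add F, LinearMap.add_apply, map_add, map_add, hF a hs ha, hF b hs' hb, hsymm b a,
      zero_add, add_zero, ← two_smul ℂ] at h
    rwa [smul_eq_zero_iff_right two_ne_zero] at h
  refine lin_ext (F a) e he (fun b hs' hb => ?_) b hb
  exact lin_ext (F.flip b) e he (fun a hs ha => h1 a b hs ha hs' hb) a ha

lemma op_bilin (T : A →L[ℂ] B) (hT : ∀ a b : A, IsOrthogonal a b → IsOrthogonal (T a) (T b))
    (e : A) (he : IsSelfAdjoint e) (a b : A) (ha : ActsUnit e a) (hb : ActsUnit e b) :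
    T (a * b + b * a) * star (T e) = T a * conjMap T b + T b * conjMap T a ∧
    star (T e) * T (a * b + b * a) = conjMap T a * T b + conjMap T b * T a := by
  constructor
  · rw [← sub_eq_zero]
    let F : A →ₗ[ℂ] A →ₗ[ℂ] B := LinearMap.mk₂ ℂ
      (fun a b => T (a * b + b * a) * star (T e) - (T a * conjMap T b + T b * conjMap T a))
      (by intro x y z; simp [add_mul, mul_add]; abel)
      (by intro r x y; simp [smul_mul_assoc, mul_smul_comm, add_mul, smul_sub])
      (by intro x y z; simp [add_mul, mul_add]; abel)
      (by intro r x y; simp [smul_mul_assoc, mul_smul_comm, add_mul, smul_sub])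
    refine bilin_ext F e he (fun a b => ?_) (fun a hs ha => ?_) a b ha hb
    · simp only [F, LinearMap.mk₂_apply]
      rw [add_comm (a * b), add_comm (T a * _)]
    · simp only [F, LinearMap.mk₂_apply, conjMap_apply]
      have := (op_sa T hT e a he hs ha.1).1.2
      rw [hs.star_eq, map_add, add_mul, this, sub_self]
  · rw [← sub_eq_zero]
    let F : A →ₗ[ℂ] A →ₗ[ℂ] B := LinearMap.mk₂ ℂ
      (fun a b => star (T e) * T (a * b + b * a) - (conjMap T a * T b + conjMap T b * T a))
      (by intro x y z; simp [add_mul, mul_add]; abel)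
      (by intro r x y; simp [smul_mul_assoc, mul_smul_comm, mul_add, smul_sub])
      (by intro x y z; simp [add_mul, mul_add]; abel)
      (by intro r x y; simp [smul_mul_assoc, mul_smul_comm, mul_add, smul_sub])
    refine bilin_ext F e he (fun a b => ?_) (fun a hs ha => ?_) a b ha hb
    · simp only [F, LinearMap.mk₂_apply]
      rw [add_comm (a * b), add_comm (conjMap T a * _)]
    · simp only [F, LinearMap.mk₂_apply, conjMap_apply]
      have := congrArg star (op_sa T hT e a he hs ha.1).2.2
      rw [star_mul, star_mul, star_star, star_star] at this
      rw [hs.star_eq, map_add, mul_add, this, sub_self]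

lemma op_triple (T : A →L[ℂ] B) (hT : ∀ a b : A, IsOrthogonal a b → IsOrthogonal (T a) (T b))
    (e : A) (he : IsSelfAdjoint e) (a b c : A) (ha : ActsUnit e a) (hb : ActsUnit e b)
    (hc : ActsUnit e c) :
    T a * conjMap T b * T c + T c * conjMap T b * T a
      = T e * star (T e) * T (a * b * c + c * b * a) := by
  set h := T e
  set U := conjMap T
  have hP : ∀ p q, ActsUnit e p → ActsUnit e q →
      T p * star h * T q + T q * star h * T p = h * star h * T (p * q + q * p) := by
    intro p q hp hq
    rw [(op_lin T hT e he p hp).1, (op_lin T hT e he q hq).1, mul_assoc h (star h),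
      (op_bilin T hT e he p q hp hq).2, mul_add, mul_assoc, mul_assoc]
  have hab := op_bilin T hT e he a b ha hb
  have hbc := op_bilin T hT e he b c hb hc
  have hac := op_bilin T hT e he a c ha hc
  have aab : ActsUnit e (a * b + b * a) := (ha.mul' hb).add' (hb.mul' ha)
  have abc : ActsUnit e (b * c + c * b) := (hb.mul' hc).add' (hc.mul' hb)
  have aac : ActsUnit e (a * c + c * a) := (ha.mul' hc).add' (hc.mul' ha)
  have p1 := hP _ _ aab hc
  have p2 := hP _ _ abc ha
  have p3 := hP _ _ aac hb
  rw [hab.1, mul_assoc (T c), hab.2] at p1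
  rw [hbc.1, mul_assoc (T a), hbc.2] at p2
  rw [hac.1, mul_assoc (T b), hac.2] at p3
  have e1 : (a * b + b * a) * c + c * (a * b + b * a) + ((b * c + c * b) * a + a * (b * c + c * b))
      - ((a * c + c * a) * b + b * (a * c + c * a)) = (2 : ℂ) • (a * b * c + c * b * a) := by
    rw [two_smul]; noncomm_ring
  have e2 := congrArg (fun x => h * star h * T x) e1
  simp only [map_sub, map_add T ((a * b + b * a) * c + c * (a * b + b * a)), map_smul, mul_sub,
    mul_add (h * star h) (T ((a * b + b * a) * c + c * (a * b + b * a))), mul_smul_comm] at e2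
  rw [← p1, ← p2, ← p3] at e2
  have : (2 : ℂ) • (T a * U b * T c + T c * U b * T a)
      = (2 : ℂ) • (h * star h * T (a * b * c + c * b * a)) := by
    rw [← e2, two_smul]; noncomm_ring
  exact smul_right_injective B (two_ne_zero (α := ℂ)) this

lemma op_comm (T : A →L[ℂ] B) (hT : ∀ a b : A, IsOrthogonal a b → IsOrthogonal (T a) (T b))
    (e : A) (he : IsSelfAdjoint e) (x y : A) (hx : ActsUnit e x) (hy : ActsUnit e y) :
    T x * conjMap T y * (T e * star (T e)) = T e * star (T e) * (T x * conjMap T y) := by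
  have x1 := op_lin T hT e he x hx
  have y1 := op_lin T hT e he y hy
  calc T x * conjMap T y * (T e * star (T e))
      = T x * (conjMap T y * T e) * star (T e) := by simp only [mul_assoc]
    _ = (T x * star (T e)) * (T y * star (T e)) := by rw [y1.2]; simp only [mul_assoc]
    _ = T e * (conjMap T x * T e) * conjMap T y := by rw [x1.1, y1.1]; simp only [mul_assoc]
    _ = _ := by rw [x1.2]; simp only [mul_assoc]
end op

section approx
open Filter Topology
variable {A B : Type*} [NonUnitalCStarAlgebra A] [NonUnitalCStarAlgebra B]

noncomputable def nFn (t : ℝ) : ℝ := min 1 (t / max (1 - t) (1 / 2))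
noncomputable def eFn (t : ℝ) : ℝ := min (2 * t) 1
noncomputable def fFn (t : ℝ) : ℝ := t - nFn t + nFn t * t

lemma nFn_cont : Continuous nFn := by
  unfold nFn
  refine continuous_const.min (continuous_id.div (by fun_prop) fun t => ?_)
  have : (1 / 2 : ℝ) ≤ max (1 - t) (1 / 2) := le_max_right _ _
  intro h
  rw [h] at this
  norm_num at this
lemma eFn_cont : Continuous eFn := by unfold eFn; fun_prop
lemma fFn_cont : Continuous fFn := by have := nFn_cont; unfold fFn; fun_prop
lemma nFn_zero : nFn 0 = 0 := by simp [nFn]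
lemma eFn_zero : eFn 0 = 0 := by simp [eFn]
lemma fFn_zero : fFn 0 = 0 := by simp [fFn, nFn_zero]
lemma nFn_bd {t : ℝ} (h0 : 0 ≤ t) : ‖nFn t‖ ≤ 1 := by
  have : 0 ≤ nFn t := by unfold nFn; positivity
  rw [Real.norm_of_nonneg this]
  exact min_le_left _ _
lemma eFn_bd {t : ℝ} (h0 : 0 ≤ t) : ‖eFn t‖ ≤ 1 := by
  have : 0 ≤ eFn t := by unfold eFn; positivity
  rw [Real.norm_of_nonneg this]
  exact min_le_right _ _
lemma fFn_bd {t : ℝ} (h0 : 0 ≤ t) (h1 : t ≤ 1) : ‖fFn t‖ ≤ 3 := by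
  have h2 := abs_le.1 (nFn_bd h0)
  unfold fFn
  rw [Real.norm_eq_abs, abs_le]
  constructor <;> nlinarith
lemma eFn_mul_fFn (t : ℝ) : eFn t * fFn t = fFn t := by
  rcases le_total t (1 / 2) with h | h
  · have : fFn t = 0 := by
      have h3 : (0 : ℝ) < 1 - t := by linarith
      have h2 : nFn t = t / (1 - t) := by
        unfold nFn
        rw [max_eq_left (by linarith), min_eq_right]
        rw [div_le_one h3]; linarith
      unfold fFn
      rw [h2]
      field_simp
      ring
    rw [this, mul_zero]
  · have : eFn t = 1 := min_eq_right (by linarith)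
    rw [this, one_mul]

lemma exists_approx : ∃ (l : Filter A) (_ : l.NeBot) (e f : A → A),
    (∀ᶠ u in l, IsSelfAdjoint (e u) ∧ ‖e u‖ ≤ 1 ∧ e u * f u = f u ∧ f u * e u = f u) ∧
    ∀ x, Tendsto (fun u => f u * x * f u) l (𝓝 x) := by
  letI : PartialOrder A := CStarAlgebra.spectralOrder A
  haveI : StarOrderedRing A := CStarAlgebra.spectralOrderedRing A
  have hl := CStarAlgebra.increasingApproximateUnit A
  set l := CStarAlgebra.approximateUnit A
  have hsp : ∀ᶠ u in l, IsSelfAdjoint u ∧ ∀ t ∈ quasispectrum ℝ u, 0 ≤ t ∧ t ≤ 1 := by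
    filter_upwards [hl.eventually_nonneg, hl.eventually_norm] with u h0 h1
    have hs : IsSelfAdjoint u := IsSelfAdjoint.of_nonneg h0
    refine ⟨hs, fun t ht => ⟨quasispectrum_nonneg_of_nonneg u h0 t ht, ?_⟩⟩
    have := norm_apply_le_norm_cfcₙ (fun x : ℝ => x) u ht
    rw [cfcₙ_id' ℝ u] at this
    exact (le_abs_self t).trans (this.trans h1)
  have cn : ∀ s, ContinuousOn nFn s := fun s => nFn_cont.continuousOn
  have ce : ∀ s, ContinuousOn eFn s := fun s => eFn_cont.continuousOn
  have cf : ∀ s, ContinuousOn fFn s := fun s => fFn_cont.continuousOn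
  refine ⟨l, hl.neBot, fun u => cfcₙ eFn u, fun u => cfcₙ fFn u, ?_, ?_⟩
  · filter_upwards [hsp] with u ⟨hu, hs⟩
    refine ⟨cfcₙ_predicate _ _, norm_cfcₙ_le fun t ht => eFn_bd (hs t ht).1, ?_, ?_⟩
    · rw [← cfcₙ_mul eFn fFn u (ce _) eFn_zero (cf _) fFn_zero]
      simp_rw [eFn_mul_fFn]
    · rw [← cfcₙ_mul fFn eFn u (cf _) fFn_zero (ce _) eFn_zero]
      simp_rw [mul_comm (fFn _), eFn_mul_fFn]
  · intro x
    have hexp : ∀ᶠ u in l, cfcₙ fFn u = u - cfcₙ nFn u + cfcₙ nFn u * u ∧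
        cfcₙ fFn u = u - cfcₙ nFn u + u * cfcₙ nFn u := by
      filter_upwards [hsp] with u ⟨hu, hs⟩
      have h1 : cfcₙ fFn u = u - cfcₙ nFn u + cfcₙ nFn u * u := by
        have := nFn_cont
        unfold fFn
        rw [cfcₙ_add (a := u) (fun t : ℝ => t - nFn t) (fun t => nFn t * t)
            (by fun_prop) (by simp [nFn_zero]) (by fun_prop) (by simp),
          cfcₙ_sub (a := u) (fun t : ℝ => t) nFn (by fun_prop) rfl (by fun_prop) nFn_zero,
          cfcₙ_mul (a := u) nFn (fun t : ℝ => t) (by fun_prop) nFn_zero (by fun_prop) rfl,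
          cfcₙ_id' ℝ u]
      refine ⟨h1, ?_⟩
      have h2 := congrArg star h1
      have s1 : IsSelfAdjoint (cfcₙ fFn u) := cfcₙ_predicate _ _
      have s2 : IsSelfAdjoint (cfcₙ nFn u) := cfcₙ_predicate _ _
      rwa [star_add, star_sub, star_mul, s1.star_eq, s2.star_eq, hu.star_eq] at h2
    have t1 : Tendsto (fun u => ‖u * x - x‖) l (𝓝 0) := by
      have := hl.tendsto_mul_right x
      simpa using (this.sub_const x).norm
    have t2 : Tendsto (fun u => ‖x * u - x‖) l (𝓝 0) := by
      have := hl.tendsto_mul_left x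
      simpa using (this.sub_const x).norm
    rw [tendsto_iff_norm_sub_tendsto_zero]
    refine squeeze_zero' (Eventually.of_forall fun _ => norm_nonneg _) ?_
      (by simpa using (t2.const_mul 6).add (t1.const_mul 2))
    filter_upwards [hsp, hexp] with u ⟨hu, hs⟩ ⟨he1, he2⟩
    have bn : ‖cfcₙ nFn u‖ ≤ 1 := norm_cfcₙ_le fun t ht => nFn_bd (hs t ht).1
    have bf : ‖cfcₙ fFn u‖ ≤ 3 := norm_cfcₙ_le fun t ht => fFn_bd (hs t ht).1 (hs t ht).2
    have i1 : cfcₙ fFn u * x - x = (u * x - x) + cfcₙ nFn u * (u * x - x) := by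
      rw [he1]; noncomm_ring
    have i2 : x * cfcₙ fFn u - x = (x * u - x) + (x * u - x) * cfcₙ nFn u := by
      rw [he2]; noncomm_ring
    have j1 : ‖cfcₙ fFn u * x - x‖ ≤ 2 * ‖u * x - x‖ := by
      rw [i1]
      have := norm_mul_le (cfcₙ nFn u) (u * x - x)
      have h2 := norm_add_le (u * x - x) (cfcₙ nFn u * (u * x - x))
      nlinarith [norm_nonneg (u * x - x)]
    have j2 : ‖x * cfcₙ fFn u - x‖ ≤ 2 * ‖x * u - x‖ := by
      rw [i2]
      have := norm_mul_le (x * u - x) (cfcₙ nFn u)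
      have h2 := norm_add_le (x * u - x) ((x * u - x) * cfcₙ nFn u)
      nlinarith [norm_nonneg (x * u - x)]
    have k : cfcₙ fFn u * x * cfcₙ fFn u - x
        = cfcₙ fFn u * (x * cfcₙ fFn u - x) + (cfcₙ fFn u * x - x) := by noncomm_ring
    rw [k]
    have h1 := norm_mul_le (cfcₙ fFn u) (x * cfcₙ fFn u - x)
    have h2 := norm_add_le (cfcₙ fFn u * (x * cfcₙ fFn u - x)) (cfcₙ fFn u * x - x)
    have h3 : ‖cfcₙ fFn u‖ * ‖x * cfcₙ fFn u - x‖ ≤ 3 * (2 * ‖x * u - x‖) := by gcongr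
    linarith

lemma tripleProduct_tendsto {ι : Type*} {l : Filter ι} {f g h : ι → A} {a b c : A}
    (hf : Tendsto f l (𝓝 a)) (hg : Tendsto g l (𝓝 b)) (hh : Tendsto h l (𝓝 c)) :
    Tendsto (fun i => tripleProduct (f i) (g i) (h i)) l (𝓝 (tripleProduct a b c)) := by
  unfold tripleProduct
  exact (((hf.mul hg.star).mul hh).add ((hh.mul hg.star).mul hf)).const_smul _

lemma ActsUnit.triple {e a b c : A} (he : IsSelfAdjoint e) (ha : ActsUnit e a)
    (hb : ActsUnit e b) (hc : ActsUnit e c) : ActsUnit e (tripleProduct a b c) :=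
  (((ha.mul' (hb.star' he)).mul' hc).add' ((hc.mul' (hb.star' he)).mul' ha)).smul' _

lemma op_tp (T : A →L[ℂ] B) (hT : ∀ a b : A, IsOrthogonal a b → IsOrthogonal (T a) (T b))
    (e : A) (he : IsSelfAdjoint e) (a b c : A) (ha : ActsUnit e a) (hb : ActsUnit e b)
    (hc : ActsUnit e c) :
    tripleProduct (T a) (T b) (T c) = T e * star (T e) * T (tripleProduct a b c) := by
  have := op_triple T hT e he a (star b) c ha (hb.star' he) hc
  rw [conjMap_apply, star_star] at this
  rw [tripleProduct, tripleProduct, this, map_smul, mul_smul_comm]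

lemma tp_self (a : A) : tripleProduct a a a = a * star a * a := by
  rw [tripleProduct, ← two_smul ℂ, smul_smul]; norm_num

lemma eq_zero_of_quint {v : A} (h : v * star v * v * star v * v = 0) : v = 0 := by
  have hs : IsSelfAdjoint (v * star v) := IsSelfAdjoint.mul_star_self v
  have h4 : (v * star v * (v * star v)) * star (v * star v * (v * star v)) = 0 := by
    rw [star_mul, hs.star_eq]
    calc v * star v * (v * star v) * (v * star v * (v * star v))
        = (v * star v * v * star v * v) * (star v * (v * star v)) := by simp only [mul_assoc]
      _ = 0 := by rw [h, zero_mul]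
  have h5 : v * star v * star (v * star v) = 0 := by
    rw [hs.star_eq]; exact (CStarRing.mul_star_self_eq_zero_iff _).1 h4
  exact (CStarRing.mul_star_self_eq_zero_iff _).1 ((CStarRing.mul_star_self_eq_zero_iff _).1 h5)

lemma op_imp (T : A →L[ℂ] B) (hinj : Function.Injective T)
    (hT : ∀ a b : A, IsOrthogonal a b → IsOrthogonal (T a) (T b)) (a b c : A) :
    tripleProduct a b c = 0 ↔ tripleProduct (T a) (T b) (T c) = 0 := by
  obtain ⟨l, _, e, f, hef, hlim⟩ := exists_approx (A := A)
  have hact : ∀ᶠ u in l, ∀ x, ActsUnit (e u) (f u * x * f u) := by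
    filter_upwards [hef] with u ⟨_, _, h1, h2⟩ x
    exact ⟨by rw [← mul_assoc, ← mul_assoc, h1], by rw [mul_assoc, h2]⟩
  have hTl : ∀ {g : A → A} {x : A}, Tendsto g l (𝓝 x) → Tendsto (fun u => T (g u)) l (𝓝 (T x)) :=
    fun h => (T.continuous.tendsto _).comp h
  set w : A → A := fun u => tripleProduct (f u * a * f u) (f u * b * f u) (f u * c * f u) with hw
  have hwl : Tendsto w l (𝓝 (tripleProduct a b c)) :=
    tripleProduct_tendsto (hlim a) (hlim b) (hlim c)
  have hTwl := hTl hwl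
  have hTtp : Tendsto (fun u => T (e u) * star (T (e u)) * T (w u)) l
      (𝓝 (tripleProduct (T a) (T b) (T c))) := by
    refine (tripleProduct_tendsto (hTl (hlim a)) (hTl (hlim b)) (hTl (hlim c))).congr' ?_
    filter_upwards [hef, hact] with u hu hx
    exact op_tp T hT (e u) hu.1 _ _ _ (hx a) (hx b) (hx c)
  constructor
  · intro h
    rw [h, map_zero] at hTwl
    refine tendsto_nhds_unique hTtp ?_
    rw [tendsto_zero_iff_norm_tendsto_zero]
    have t0 : Tendsto (fun u => ‖T‖ * ‖T‖ * ‖T (w u)‖) l (𝓝 0) := by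
      simpa using hTwl.norm.const_mul (‖T‖ * ‖T‖)
    refine squeeze_zero' (Eventually.of_forall fun _ => norm_nonneg _) ?_ t0
    filter_upwards [hef] with u hu
    have h1 : ‖T (e u)‖ ≤ ‖T‖ := by
      have h2 := T.le_opNorm (e u)
      have h3 := mul_le_mul_of_nonneg_left hu.2.1 (norm_nonneg T)
      linarith
    refine (norm_mul_le _ _).trans ?_
    gcongr
    refine (norm_mul_le _ _).trans ?_
    rw [norm_star]
    gcongr
  · intro h
    rw [h] at hTtp
    set v := tripleProduct a b c
    have hcl : Tendsto (fun u => T (tripleProduct (w u) (w u) (w u))) l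
      (𝓝 (T (tripleProduct v v v))) := hTl (tripleProduct_tendsto hwl hwl hwl)
    have q1 : Tendsto (fun u => T (w u) * star (T (w u)) * T (w u) * star (T (w u)) * T (w u)) l
        (𝓝 (T v * star (T v) * T v * star (T v) * T v)) :=
      (((hTwl.mul hTwl.star).mul hTwl).mul hTwl.star).mul hTwl
    have q2 : Tendsto (fun u => T (tripleProduct (w u) (w u) (w u)) * star (T (w u)) *
        (T (e u) * star (T (e u)) * T (w u))) l
        (𝓝 (T (tripleProduct v v v) * star (T v) * 0)) := (hcl.mul hTwl.star).mul hTtp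
    rw [mul_zero] at q2
    have q3 := tendsto_nhds_unique q1 (q2.congr' ?_)
    · exact hinj (by rw [eq_zero_of_quint q3, map_zero])
    · filter_upwards [hef, hact] with u hu hx
      have hwu : ActsUnit (e u) (w u) := ActsUnit.triple hu.1 (hx a) (hx b) (hx c)
      have r1 := op_tp T hT (e u) hu.1 _ _ _ hwu hwu hwu
      have r2 := op_comm T hT (e u) hu.1 _ _ (ActsUnit.triple hu.1 hwu hwu hwu) (hwu.star' hu.1)
      rw [tp_self] at r1
      rw [conjMap_apply, star_star] at r2
      rw [r1, ← mul_assoc (_ * _) (_ * _) (T (w u)), r2]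
      simp only [mul_assoc]

lemma tp_imp (T : A →L[ℂ] B) (hsurj : Function.Surjective T)
    (hT : ∀ a b c : A, tripleProduct a b c = 0 → tripleProduct (T a) (T b) (T c) = 0)
    (a b : A) (hab : IsOrthogonal a b) : IsOrthogonal (T a) (T b) := by
  set u := T a
  set v := T b
  have hy : ∀ y, u * star v * y + y * (star v * u) = 0 := by
    intro y
    obtain ⟨x, rfl⟩ := hsurj y
    have := hT a b x (by
      rw [tripleProduct, hab.1, mul_assoc x, hab.2, zero_mul, mul_zero, add_zero, smul_zero])
    rw [tripleProduct, smul_eq_zero_iff_right (by norm_num)] at this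
    rw [← this, mul_assoc (T x)]
  have huvu : u * star v * u = 0 := by
    have := hy u
    rw [← mul_assoc u, ← two_smul ℂ, smul_eq_zero_iff_right two_ne_zero] at this
    exact this
  set q := star v * u with hq
  have hqq : q * q = 0 := by
    rw [hq, mul_assoc, ← mul_assoc u, huvu, mul_zero]
  have hzero : ∀ z : B, (∀ y, y * z = 0) → z = 0 := fun z h =>
    (CStarRing.star_mul_self_eq_zero_iff _).1 (h (star z))
  have hcomm : ∀ z, q * z = z * q := by
    intro z
    rw [← sub_eq_zero]
    refine hzero _ fun y => ?_
    have h1 := hy (y * z)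
    have h2 : (u * star v * y + y * q) * z = 0 := by rw [hy y, zero_mul]
    rw [mul_sub, sub_eq_zero]
    rw [add_mul, mul_assoc, ] at h2
    rw [← mul_assoc y q z, ← mul_assoc y z q]
    exact add_left_cancel (h2.trans h1.symm)
  have hq0 : q = 0 := by
    have h1 : (star q * q) * star (star q * q) = 0 := by
      rw [(IsSelfAdjoint.star_mul_self q).star_eq]
      calc star q * q * (star q * q) = star q * (q * star q) * q := by simp only [mul_assoc]
        _ = star q * star q * (q * q) := by rw [hcomm (star q)]; simp only [mul_assoc]
        _ = 0 := by rw [hqq, mul_zero]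
    exact (CStarRing.star_mul_self_eq_zero_iff _).1 ((CStarRing.mul_star_self_eq_zero_iff _).1 h1)
  refine ⟨?_, hq0⟩
  have := hy (star (u * star v))
  rw [hq0, mul_zero, add_zero] at this
  exact (CStarRing.mul_star_self_eq_zero_iff _).1 this

end approx

/-- For a bijective bounded linear operator between C*-algebras, the following are
equivalent: it is orthogonality preserving; it preserves zero triple products; it
preserves zero triple products in both directions. -/
theorem bijective_orthogonality_preserving_tfae {A B : Type*}
    [NonUnitalCStarAlgebra A] [NonUnitalCStarAlgebra B] (T : A →L[ℂ] B)
    (hbij : Function.Bijective T) :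
    List.TFAE [
      ∀ a b : A, IsOrthogonal a b → IsOrthogonal (T a) (T b),
      ∀ a b c : A, tripleProduct a b c = 0 → tripleProduct (T a) (T b) (T c) = 0,
      ∀ a b c : A, tripleProduct a b c = 0 ↔ tripleProduct (T a) (T b) (T c) = 0] := by
  tfae_have 1 → 3 := fun h a b c => op_imp T hbij.1 h a b c
  tfae_have 3 → 2 := fun h a b c => (h a b c).1
  tfae_have 2 → 1 := fun h a b hab => tp_imp T hbij.2 h a b hab
  tfae_finish
end

section
/- Let A be a commutative C*-algebra and let {U_t : t ∈ ℝ≥0} be a uniformly continuous one-parameter semigroup of bounded linear operators on A such that each U_t is a Jordan *-automorphism (a bijection with U_t(a ∘ b) = U_t(a) ∘ U_t(b) and U_t(a*) = U_t(a)* for all a, b ∈ A). Then U_t = Id for every t ≥ 0. -/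
/-- Evaluation of the real functional calculus at a real point of `ℂ`. -/
lemma aux_cfcn_complex (f : ℝ → ℝ) (hf : Continuous f) (hf0 : f 0 = 0) (x : ℝ) :
    cfcₙ f (x : ℂ) = (f x : ℂ) := by
  rw [cfcₙ_eq_cfc (hf := hf.continuousOn) (hf0 := hf0)]
  exact cfc_algebraMap (A := ℂ) x f

/-- A character commutes with the functional calculus. -/
lemma aux_char_cfcn {A : Type*} [NonUnitalCommCStarAlgebra A] (χ : A →⋆ₙₐ[ℂ] ℂ)
    (f : ℝ → ℝ) (hf : Continuous f) (hf0 : f 0 = 0) (a : A) (ha : IsSelfAdjoint a) :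
    χ (cfcₙ f a) = (f (χ a).re : ℂ) := by
  have hχ : IsSelfAdjoint (χ a) := ha.map χ
  have hre : (((χ a).re : ℝ) : ℂ) = χ a := Complex.conj_eq_iff_re.mp hχ
  have hc : Continuous χ := by
    exact AddMonoidHomClass.continuous_of_bound χ 1 (fun x => by
      simpa using NonUnitalStarAlgHom.norm_apply_le χ x)
  have h := NonUnitalStarAlgHomClass.map_cfcₙ (R := ℝ) (S := ℂ) χ f a
    (hf := hf.continuousOn) (hf₀ := hf0) (hφ := hc) (ha := ha) (hφa := hχ)
  rw [h, ← aux_cfcn_complex f hf hf0, hre]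

/-- A bump function. -/
lemma aux_bump (x y : ℝ) (hx : x ≠ 0) (hxy : x ≠ y) :
    ∃ f : ℝ → ℝ, Continuous f ∧ f 0 = 0 ∧ f x = 1 ∧ f y = 0 ∧ ∀ z, |f z| ≤ 1 := by
  have hd : 0 < min |x| |x - y| := lt_min (abs_pos.2 hx) (abs_pos.2 (sub_ne_zero.2 hxy))
  set d := min |x| |x - y| with hdd
  refine ⟨fun z => max 0 (1 - |z - x| / d), by fun_prop, ?_, ?_, ?_, ?_⟩
  · have : 1 ≤ |0 - x| / d := by
      rw [le_div_iff₀ hd, zero_sub, abs_neg, one_mul]; exact min_le_left _ _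
    exact max_eq_left (by linarith)
  · simp
  · have : 1 ≤ |y - x| / d := by
      rw [le_div_iff₀ hd, abs_sub_comm, one_mul]; exact min_le_right _ _
    exact max_eq_left (by linarith)
  · intro z
    have : 0 ≤ |z - x| / d := by positivity
    rw [abs_of_nonneg (le_max_left _ _)]
    exact max_le zero_le_one (by linarith)

/-- Two characters at distance less than one agree on self-adjoint elements. -/
lemma aux_char_eq {A : Type*} [NonUnitalCommCStarAlgebra A] (χ ψ : A →⋆ₙₐ[ℂ] ℂ)
    (h : ∀ a : A, ‖a‖ ≤ 1 → ‖χ a - ψ a‖ < 1) (a : A) (ha : IsSelfAdjoint a) :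
    χ a = ψ a := by
  have hχ : (((χ a).re : ℝ) : ℂ) = χ a := Complex.conj_eq_iff_re.mp (ha.map χ)
  have hψ : (((ψ a).re : ℝ) : ℂ) = ψ a := Complex.conj_eq_iff_re.mp (ha.map ψ)
  by_contra hne
  have hre : (χ a).re ≠ (ψ a).re := fun e => hne (by rw [← hχ, ← hψ, e])
  have key : ∀ f : ℝ → ℝ, Continuous f → f 0 = 0 → (∀ z, |f z| ≤ 1) →
      |f (χ a).re - f (ψ a).re| < 1 := by
    intro f hf hf0 hb
    have hn : ‖cfcₙ f a‖ ≤ 1 := norm_cfcₙ_le (fun z _ => hb z)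
    have := h _ hn
    rw [aux_char_cfcn χ f hf hf0 a ha, aux_char_cfcn ψ f hf hf0 a ha, ← Complex.ofReal_sub,
      Complex.norm_real] at this
    exact this
  by_cases h0 : (χ a).re = 0
  · obtain ⟨f, hf, hf0, h1, h2, hb⟩ := aux_bump (ψ a).re (χ a).re (fun e => hre (h0.trans e.symm)) hre.symm
    have := key f hf hf0 hb
    rw [h1, h2] at this
    norm_num at this
  · obtain ⟨f, hf, hf0, h1, h2, hb⟩ := aux_bump (χ a).re (ψ a).re h0 hre
    have := key f hf hf0 hb
    rw [h1, h2] at this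
    norm_num at this

/-- Characters separate points. -/
lemma aux_separate {A : Type*} [NonUnitalCommCStarAlgebra A] (c : A)
    (h : ∀ χ : A →⋆ₙₐ[ℂ] ℂ, χ c = 0) : c = 0 := by
  have h1 : WeakDual.gelfandTransform ℂ (Unitization ℂ A) (c : Unitization ℂ A) = 0 := by
    ext χ
    have := h ((NonUnitalStarAlgHomClass.toNonUnitalStarAlgHom χ :
      Unitization ℂ A →⋆ₙₐ[ℂ] ℂ).comp (Unitization.inrNonUnitalStarAlgHom ℂ A))
    exact this
  have h2 := (gelfandTransform_isometry (Unitization ℂ A)).injective (h1.trans (map_zero _).symm)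
  exact Unitization.inr_injective (R := ℂ) h2

/-- A star endomorphism at distance less than one from the identity is the identity. -/
lemma aux_hom_eq {A : Type*} [NonUnitalCommCStarAlgebra A] (φ : A →⋆ₙₐ[ℂ] A)
    (h : ∀ a : A, ‖a‖ ≤ 1 → ‖φ a - a‖ < 1) (a : A) : φ a = a := by
  have hsa : ∀ a : A, IsSelfAdjoint a → φ a = a := by
    intro a ha
    refine sub_eq_zero.1 (aux_separate _ fun χ => ?_)
    rw [map_sub, sub_eq_zero]
    refine aux_char_eq (χ.comp φ) χ (fun b hb => ?_) a ha
    have : (χ.comp φ) b - χ b = χ (φ b - b) := by rw [map_sub]; rfl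
    rw [this]
    exact (NonUnitalStarAlgHom.norm_apply_le χ _).trans_lt (h b hb)
  rw [← realPart_add_I_smul_imaginaryPart a, map_add, map_smul, hsa _ (realPart a).2,
    hsa _ (imaginaryPart a).2]


/-- On a commutative C*-algebra, every uniformly continuous one-parameter semigroup of
Jordan *-automorphisms is trivial: `U_t = Id` for every `t ≥ 0`. -/
theorem one_parameter_semigroup_of_jordan_star_automorphisms_comm {A : Type*}
    [NonUnitalCommCStarAlgebra A] (U : ℝ → A →L[ℂ] A)
    (hU0 : U 0 = ContinuousLinearMap.id ℂ A)
    (hUadd : ∀ t s : ℝ, 0 ≤ t → 0 ≤ s → U (t + s) = (U t).comp (U s))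
    (hUcont : Filter.Tendsto (fun t : ℝ => ‖U t - ContinuousLinearMap.id ℂ A‖)
      (nhdsWithin 0 (Set.Ioi 0)) (nhds 0))
    (hbij : ∀ t : ℝ, 0 ≤ t → Function.Bijective (U t))
    (hjordan : ∀ t : ℝ, 0 ≤ t → ∀ a b : A,
      U t ((2 : ℂ)⁻¹ • (a * b + b * a)) = (2 : ℂ)⁻¹ • (U t a * U t b + U t b * U t a))
    (hstar : ∀ t : ℝ, 0 ≤ t → ∀ a : A, U t (star a) = star (U t a)) :
    ∀ t : ℝ, 0 ≤ t → U t = ContinuousLinearMap.id ℂ A := by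
  have hmul : ∀ t : ℝ, 0 ≤ t → ∀ a b : A, U t (a * b) = U t a * U t b := by
    intro t ht a b
    have h2 : ∀ x : A, (2 : ℂ)⁻¹ • (x + x) = x := fun x => by
      rw [← two_smul ℂ x, smul_smul]; norm_num
    have := hjordan t ht a b
    rwa [mul_comm b a, mul_comm (U t b) (U t a), h2, h2] at this
  have hsmall : ∀ t : ℝ, 0 ≤ t → ‖U t - ContinuousLinearMap.id ℂ A‖ < 1 →
      U t = ContinuousLinearMap.id ℂ A := by
    intro t ht hn
    let φ : A →⋆ₙₐ[ℂ] A :=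
      { toFun := U t
        map_smul' := fun c x => (U t).map_smul c x
        map_zero' := (U t).map_zero
        map_add' := fun x y => (U t).map_add x y
        map_mul' := hmul t ht
        map_star' := hstar t ht }
    ext a
    refine aux_hom_eq φ (fun b hb => ?_) a
    have h1 := (U t - ContinuousLinearMap.id ℂ A).le_opNorm b
    have h2 : ‖U t - ContinuousLinearMap.id ℂ A‖ * ‖b‖ ≤ ‖U t - ContinuousLinearMap.id ℂ A‖ :=
      mul_le_of_le_one_right (norm_nonneg _) hb
    exact (h1.trans h2).trans_lt hn
  have hev := hUcont.eventually (gt_mem_nhds (zero_lt_one (α := ℝ)))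
  rw [eventually_nhdsWithin_iff, Metric.eventually_nhds_iff] at hev
  obtain ⟨ε, hε, hev⟩ := hev
  intro t ht
  rcases ht.eq_or_lt with rfl | htp
  · exact hU0
  obtain ⟨n, hn⟩ := exists_nat_gt (t / ε)
  have hn0 : (0 : ℝ) < n := (by positivity : (0 : ℝ) ≤ t / ε).trans_lt hn
  have hs : 0 < t / n := by positivity
  have hsε : t / n < ε := by
    rw [div_lt_iff₀ hε] at hn
    rw [div_lt_iff₀ hn0]; linarith
  have hid : U (t / n) = ContinuousLinearMap.id ℂ A := by
    refine hsmall _ hs.le (hev ?_ hs)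
    rwa [Real.dist_eq, sub_zero, abs_of_pos hs]
  have hk : ∀ k : ℕ, U (k * (t / n)) = ContinuousLinearMap.id ℂ A := by
    intro k
    induction k with
    | zero => simpa using hU0
    | succ k ih =>
      rw [Nat.cast_succ, add_mul, one_mul, hUadd _ _ (by positivity) hs.le, ih, hid]
      rfl
  have := hk n
  rwa [mul_div_cancel₀ _ hn0.ne'] at this
end

section
/- Every surjective linear isometry T between C*-algebras A and B preserves the triple product: T({x,y,z}) = {T(x),T(y),T(z)} for all x, y, z ∈ A, i.e., T is a triple isomorphism. -/
/-- Infinitesimal invariance of the unit ball, unital case. -/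
theorem tp_unital {A : Type*} [CStarAlgebra A] (x a : A) (hx : ‖x‖ ≤ 1) :
    ‖x + (a - x * star a * x)‖ ^ 2 ≤ 1 + 5 * ‖a‖ ^ 2 := by
  letI := CStarAlgebra.spectralOrder A
  haveI := CStarAlgebra.spectralOrderedRing A
  set d := a - x * star a * x with hd
  set c := star x * a with hc
  set q := 1 - star x * x with hq
  have hq0 : 0 ≤ q := by
    have h1 : star x * x ≤ algebraMap ℝ A (1 : ℝ) := by
      rw [← CStarAlgebra.norm_le_iff_le_algebraMap (star x * x) zero_le_one
        (star_mul_self_nonneg x), CStarRing.norm_star_mul_self]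
      nlinarith [norm_nonneg x]
    simpa [hq] using h1
  have hq1 : q ≤ 1 := by simp [hq, star_mul_self_nonneg]
  have key : star (x + d) * (x + d) =
      1 - (1 - c) * q * star (1 - c) + c * q * star c + star d * d := by
    simp only [hd, hc, hq, star_add, star_sub, star_mul, star_star, star_one]
    noncomm_ring
  have h1 : 0 ≤ (1 - c) * q * star (1 - c) := star_right_conjugate_nonneg hq0 _
  have h2 : c * q * star c ≤ algebraMap ℝ A (‖a‖ ^ 2) := by
    have h3 : c * q * star c ≤ c * 1 * star c := star_right_conjugate_le_conjugate hq1 _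
    have h4 : c * star c ≤ algebraMap ℝ A (‖a‖ ^ 2) := by
      rw [← CStarAlgebra.norm_le_iff_le_algebraMap _ (by positivity) (mul_star_self_nonneg c),
        CStarRing.norm_self_mul_star]
      have : ‖c‖ ≤ ‖a‖ := by
        calc ‖c‖ ≤ ‖star x‖ * ‖a‖ := norm_mul_le _ _
          _ ≤ 1 * ‖a‖ := by rw [norm_star]; gcongr
          _ = ‖a‖ := one_mul _
      nlinarith [norm_nonneg c]
    simpa using h3.trans (by simpa using h4)
  have h5 : star d * d ≤ algebraMap ℝ A (4 * ‖a‖ ^ 2) := by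
    rw [← CStarAlgebra.norm_le_iff_le_algebraMap _ (by positivity) (star_mul_self_nonneg d),
      CStarRing.norm_star_mul_self]
    have : ‖d‖ ≤ 2 * ‖a‖ := by
      calc ‖d‖ ≤ ‖a‖ + ‖x * star a * x‖ := norm_sub_le _ _
        _ ≤ ‖a‖ + ‖x‖ * ‖star a‖ * ‖x‖ := by
          gcongr; exact (norm_mul_le _ _).trans (by gcongr; exact norm_mul_le _ _)
        _ ≤ ‖a‖ + 1 * ‖a‖ * 1 := by rw [norm_star]; gcongr
        _ = 2 * ‖a‖ := by ring
    nlinarith [norm_nonneg d]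
  have h6 : star (x + d) * (x + d) ≤ algebraMap ℝ A (1 + 5 * ‖a‖ ^ 2) := by
    rw [key]
    have : algebraMap ℝ A (1 + 5 * ‖a‖ ^ 2) =
      1 - 0 + algebraMap ℝ A (‖a‖ ^ 2) + algebraMap ℝ A (4 * ‖a‖ ^ 2) := by
      rw [sub_zero, ← map_one (algebraMap ℝ A), ← map_add, ← map_add]; congr 1; ring
    rw [this]
    gcongr
  rw [← CStarAlgebra.norm_le_iff_le_algebraMap _ (by positivity) (star_mul_self_nonneg _),
    CStarRing.norm_star_mul_self] at h6
  nlinarith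

/-- Infinitesimal invariance of the unit ball. -/
theorem tp_nonunital {A : Type*} [NonUnitalCStarAlgebra A] (x a : A) (hx : ‖x‖ ≤ 1) :
    ‖x + (a - x * star a * x)‖ ≤ 1 + 5 * ‖a‖ ^ 2 := by
  have h := tp_unital (x : Unitization ℂ A) (a : Unitization ℂ A)
    (by rwa [Unitization.norm_inr])
  rw [← Unitization.inr_star, ← Unitization.inr_mul, ← Unitization.inr_mul,
    ← Unitization.inr_sub, ← Unitization.inr_add, Unitization.norm_inr, Unitization.norm_inr] at h
  nlinarith [norm_nonneg (x + (a - x * star a * x)), norm_nonneg a]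

/-- A homogeneous quadratic vector field tangent to the unit ball vanishes. -/
theorem tp_quadratic_zero {E : Type*} [NormedAddCommGroup E] [NormedSpace ℂ E] (Q : E → E)
    (hQd : Differentiable ℂ Q) (hQh : ∀ (c : ℂ) (x : E), Q (c • x) = c ^ 2 • Q x)
    (C : ℝ) (hC : 0 ≤ C)
    (hQ : ∀ (x : E), ‖x‖ ≤ 1 → ∀ t : ℝ, ‖x + (t : ℂ) • Q x‖ ≤ 1 + C * t ^ 2)
    (x : E) (hx : ‖x‖ ≤ 1) : Q x = 0 := by
  have hstep : ∀ (t : ℝ) (g : E), ‖g‖ ≤ 2 → ‖g + (t : ℂ) • Q g‖ ≤ ‖g‖ + 8 * C * t ^ 2 := by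
    intro t g hg
    rcases eq_or_ne g 0 with rfl | h0
    · have := hQh 0 0
      simp at this
      simp [this]; positivity
    have hr : 0 < ‖g‖ := norm_pos_iff.2 h0
    have hrc : (‖g‖ : ℂ) ≠ 0 := by exact_mod_cast hr.ne'
    set u : E := (‖g‖ : ℂ)⁻¹ • g with hu
    have hgu : g = (‖g‖ : ℂ) • u := by rw [hu, smul_smul, mul_inv_cancel₀ hrc, one_smul]
    have hun : ‖u‖ ≤ 1 := by
      rw [hu, norm_smul, norm_inv, Complex.norm_real, norm_norm, inv_mul_cancel₀ hr.ne']
    have h1 := hQ u hun (t * ‖g‖)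
    have h2 : g + (t : ℂ) • Q g = (‖g‖ : ℂ) • (u + ((t * ‖g‖ : ℝ) : ℂ) • Q u) := by
      have : Q g = (‖g‖ : ℂ) ^ 2 • Q u := by rw [← hQh, ← hgu]
      rw [this, smul_add, ← hgu, smul_smul, smul_smul]
      push_cast
      congr 2; ring
    rw [h2, norm_smul, Complex.norm_real, norm_norm]
    have h3 : ‖g‖ ^ 3 ≤ 2 ^ 3 := by gcongr
    have h4 : C * t ^ 2 * ‖g‖ ^ 3 ≤ C * t ^ 2 * 2 ^ 3 := by gcongr
    nlinarith
  have hbd : ∀ s : ℝ, 0 < s → s * ‖Q x‖ ≤ 3 := by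
    intro s hs
    obtain ⟨n, hn⟩ := exists_nat_gt (8 * C * s ^ 2)
    have hn0 : (0 : ℝ) < n := lt_of_le_of_lt (by positivity) hn
    set t : ℝ := s / n with ht
    have hnt : n * t = s := by rw [ht]; field_simp
    have htn : 8 * C * t ^ 2 * n ≤ 1 := by
      have : 8 * C * t ^ 2 * n = 8 * C * s ^ 2 / n := by rw [ht]; field_simp
      rw [this, div_le_one hn0]; exact hn.le
    let h : ℕ → ℂ → E := fun k => Nat.rec (fun _ => 0)
      (fun _ hk ζ => hk ζ + (t : ℂ) • Q (x + ζ • hk ζ)) k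
    have hs0 : ∀ ζ, h 0 ζ = 0 := fun _ => rfl
    have hss : ∀ k ζ, h (k + 1) ζ = h k ζ + (t : ℂ) • Q (x + ζ • h k ζ) := fun _ _ => rfl
    have hdiff : ∀ k, Differentiable ℂ (h k) := by
      intro k
      induction k with
      | zero => exact differentiable_const _
      | succ k ih =>
        have : h (k + 1) = fun ζ => h k ζ + (t : ℂ) • Q (x + ζ • h k ζ) := rfl
        rw [this]
        have h1 : Differentiable ℂ fun ζ : ℂ => x + ζ • h k ζ :=
          (differentiable_id.smul ih).const_add x
        exact ih.add ((hQd.comp h1).const_smul _)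
    have hzero : ∀ k : ℕ, h k 0 = ((k * t : ℝ) : ℂ) • Q x := by
      intro k
      induction k with
      | zero => simp [hs0]
      | succ k ih =>
        rw [hss, zero_smul, add_zero, ih, ← add_smul]; push_cast; congr 1; ring
    have hnorm : ∀ (k : ℕ) (ζ : ℂ), ‖ζ‖ = 1 → k ≤ n →
        ‖ζ • x + ζ ^ 2 • h k ζ‖ ≤ 1 + 8 * C * t ^ 2 * k := by
      intro k ζ hζ
      induction k with
      | zero => intro _; simpa [hs0, norm_smul, hζ] using hx
      | succ k ih =>
        intro hk
        have h1 := ih (by omega)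
        have hkn : (k : ℝ) ≤ n := by exact_mod_cast (by omega : k ≤ n)
        have h2 : 8 * C * t ^ 2 * k ≤ 8 * C * t ^ 2 * n := by gcongr
        have h3 := hstep t _ (h1.trans (by linarith))
        have h4 : ζ • x + ζ ^ 2 • h k ζ = ζ • (x + ζ • h k ζ) := by
          rw [smul_add, smul_smul, sq]
        have h5 : ζ • x + ζ ^ 2 • h (k + 1) ζ = ζ • x + ζ ^ 2 • h k ζ +
            (t : ℂ) • Q (ζ • x + ζ ^ 2 • h k ζ) := by
          rw [hss, h4, hQh, smul_add, ← h4, add_assoc, smul_comm (t : ℂ)]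
        rw [h5]
        push_cast
        linarith
    have hsph : ∀ ζ ∈ frontier (Metric.ball (0 : ℂ) 1), ‖h n ζ‖ ≤ 3 := by
      intro ζ hζ
      rw [frontier_ball _ one_ne_zero] at hζ
      have hζ1 : ‖ζ‖ = 1 := by simpa using hζ
      have h1 := hnorm n ζ hζ1 le_rfl
      have h2 : ‖h n ζ‖ = ‖(ζ • x + ζ ^ 2 • h n ζ) - ζ • x‖ := by
        rw [add_sub_cancel_left, norm_smul, norm_pow, hζ1]; simp
      rw [h2]
      have h3 : ‖ζ • x‖ ≤ 1 := by rw [norm_smul, hζ1, one_mul]; exact hx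
      have h4 := norm_sub_le (ζ • x + ζ ^ 2 • h n ζ) (ζ • x)
      linarith
    have hmax := Complex.norm_le_of_forall_mem_frontier_norm_le Metric.isBounded_ball
      (hdiff n).diffContOnCl hsph (subset_closure (Metric.mem_ball_self one_pos))
    rw [hzero, hnt, norm_smul, Complex.norm_real, Real.norm_of_nonneg hs.le] at hmax
    exact hmax
  by_contra hne
  have hpos : 0 < ‖Q x‖ := norm_pos_iff.2 hne
  have := hbd (4 / ‖Q x‖) (by positivity)
  rw [div_mul_cancel₀ _ hpos.ne'] at this
  norm_num at this

/-- Surjective isometries preserve the quadratic maps `x ↦ x a* x`. -/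
theorem tp_quadratic {A B : Type*}
    [NonUnitalCStarAlgebra A] [NonUnitalCStarAlgebra B] (T : A ≃ₗᵢ[ℂ] B) (a x : A) :
    T (x * star a * x) = T x * star (T a) * T x := by
  let Q : A → A := fun x => T.symm (T x * star (T a) * T x) - x * star a * x
  have hmul : ∀ (D : Type _) [NonUnitalCStarAlgebra D] (b : D),
      Differentiable ℂ fun x : D => x * b * x := by
    intro D _ b
    have : Differentiable ℂ fun x : D =>
      (ContinuousLinearMap.mul ℂ D) ((ContinuousLinearMap.mul ℂ D) x b) x := by fun_prop
    simpa using this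
  have hmulB : ∀ (b : B), Differentiable ℂ fun x : B => x * b * x := by
    intro b
    have : Differentiable ℂ fun x : B =>
      (ContinuousLinearMap.mul ℂ B) ((ContinuousLinearMap.mul ℂ B) x b) x := by fun_prop
    simpa using this
  have hQd : Differentiable ℂ Q := by
    have h1 := T.symm.differentiable.comp ((hmulB (star (T a))).comp T.differentiable)
    exact h1.sub (hmul A (star a))
  have hQh : ∀ (c : ℂ) (x : A), Q (c • x) = c ^ 2 • Q x := by
    intro c x
    simp only [Q, map_smul, smul_mul_assoc, mul_smul_comm, smul_sub, smul_smul, sq]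
  have hQb : ∀ (x : A), ‖x‖ ≤ 1 → ∀ t : ℝ,
      ‖x + (t : ℂ) • Q x‖ ≤ 1 + (20 * ‖a‖ ^ 2) * t ^ 2 := by
    intro x hx t
    have h1 := tp_nonunital x ((2 * t : ℂ) • a) hx
    have h2 := tp_nonunital (T x) (-(2 * t : ℂ) • T a) (by simpa using hx)
    have e : x + (t : ℂ) • Q x =
        (2⁻¹ : ℂ) • ((x + ((2 * t : ℂ) • a - x * star ((2 * t : ℂ) • a) * x)) +
          T.symm (T x + (-(2 * t : ℂ) • T a - T x * star (-(2 * t : ℂ) • T a) * T x))) := by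
      simp only [Q, map_add, map_sub, map_smul, map_neg, LinearIsometryEquiv.symm_apply_apply,
        star_smul, star_neg, star_mul', Complex.star_def, Complex.conj_ofReal, map_mul,
        map_ofNat, mul_smul_comm, smul_mul_assoc, neg_smul, mul_neg, neg_mul]
      module
    rw [e, norm_smul]
    have h3 := norm_add_le (x + ((2 * t : ℂ) • a - x * star ((2 * t : ℂ) • a) * x))
          (T.symm (T x + (-(2 * t : ℂ) • T a - T x * star (-(2 * t : ℂ) • T a) * T x)))
    rw [LinearIsometryEquiv.norm_map] at h3
    have n1 : ‖(2 * t : ℂ) • a‖ ^ 2 = 4 * t ^ 2 * ‖a‖ ^ 2 := by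
      rw [norm_smul, norm_mul, Complex.norm_real, mul_pow, mul_pow, Real.norm_eq_abs, sq_abs]
      norm_num
    have n2 : ‖-(2 * t : ℂ) • T a‖ ^ 2 = 4 * t ^ 2 * ‖a‖ ^ 2 := by
      rw [neg_smul, norm_neg, norm_smul, T.norm_map, ← norm_smul, n1]
    rw [n1] at h1
    rw [n2] at h2
    have : ‖(2⁻¹ : ℂ)‖ = 2⁻¹ := by norm_num
    rw [this]
    linarith
  have hz := tp_quadratic_zero Q hQd hQh _ (by positivity) hQb
  have hQx : Q x = 0 := by
    rcases eq_or_ne x 0 with rfl | h0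
    · simp [Q]
    have hr : (‖x‖ : ℂ) ≠ 0 := by exact_mod_cast (norm_pos_iff.2 h0).ne'
    have h1 := hz ((‖x‖ : ℂ)⁻¹ • x) (by
      rw [norm_smul, norm_inv, Complex.norm_real, norm_norm,
        inv_mul_cancel₀ (norm_pos_iff.2 h0).ne'])
    rw [hQh] at h1
    exact (smul_eq_zero.1 h1).resolve_left (pow_ne_zero _ (inv_ne_zero hr))
  have := congrArg T (sub_eq_zero.1 hQx)
  rw [T.apply_symm_apply] at this
  exact this.symm

/-- Every surjective linear isometry between C*-algebras preserves the triple product,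
i.e., it is a triple isomorphism. -/
theorem surjective_linear_isometry_preserves_tripleProduct {A B : Type*}
    [NonUnitalCStarAlgebra A] [NonUnitalCStarAlgebra B] (T : A →ₗᵢ[ℂ] B)
    (hsurj : Function.Surjective T) :
    ∀ x y z : A, T (tripleProduct x y z) = tripleProduct (T x) (T y) (T z) := by
  intro x y z
  have key : ∀ a x : A, T (x * star a * x) = T x * star (T a) * T x :=
    fun a x => tp_quadratic (LinearIsometryEquiv.ofSurjective T hsurj) a x
  have h := key y (x + z)
  simp only [add_mul, mul_add, map_add, key] at h
  have h' : T (x * star y * z) + T (z * star y * x) =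
      T x * star (T y) * T z + T z * star (T y) * T x := by
    have e : (T (x * star y * z) + T (z * star y * x)) -
      (T x * star (T y) * T z + T z * star (T y) * T x) = 0 := by
      rw [← sub_eq_zero] at h
      rw [← h]; abel
    exact sub_eq_zero.1 e
  simp only [tripleProduct, map_smul, map_add, h']
end
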